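/- Let R be a commutative ring, X a type, J a finite set (of colors), and for each pair (j,j') ∈ J × J a kernel φ_{j,j'} : X × X → R. For a dimension vector v : J → ℕ, a v-tuple is a family λ = (λ^j_s)_{j∈J, 1≤s≤v(j)} of elements of X. For dimension vectors v₁, v₂ and functions f : {v₁-tuples} → R, g : {v₂-tuples} → R, define f⋆g on (v₁+v₂)-tuples by (f⋆g)(λ) = Σ_{(τ_j)_{j∈J} ∈ ∏_{j∈J} Sh(v₁(j),v₂(j))} f((λ^j_{τ_j(s)})_{j∈J,1≤s≤v₁(j)})·g((λ^j_{τ_j(v₁(j)+t)})_{j∈J,1≤t≤v₂(j)})·∏_{j,j'∈J}∏_{s=1}^{v₁(j)}∏_{t=1}^{v₂(j')} φ_{j,j'}(λ^j_{τ_j(s)}, λ^{j'}_{τ_{j'}(v₁(j')+t)}). Then this colored shuffle product is associative: (f⋆g)⋆h = f⋆(g⋆h) for all f, g, h defined on v₁-, v₂-, v₃-tuples respectively. -/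

import Mathlib

open scoped Classical

noncomputable section

/-- An `(n,m)`-shuffle: a permutation of `{1,…,n+m}` strictly increasing on the
first block `{1,…,n}` and on the second block `{n+1,…,n+m}`. -/
def IsShuffle (n m : ℕ) (τ : Equiv.Perm (Fin (n + m))) : Prop :=
  StrictMono (fun i : Fin n => τ (Fin.castAdd m i)) ∧
  StrictMono (fun j : Fin m => τ (Fin.natAdd n j))

/-- A colored shuffle: for each color `j` an `(v₁(j), v₂(j))`-shuffle. -/
def IsColoredShuffle {J : Type*} (v₁ v₂ : J → ℕ)
    (τ : (j : J) → Equiv.Perm (Fin (v₁ j + v₂ j))) : Prop :=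
  ∀ j, IsShuffle (v₁ j) (v₂ j) (τ j)

/-- The colored kernel shuffle product `f ⋆ g` with kernels `φ j j'`. -/
def coloredShuffleMul {R X J : Type*} [CommRing R] [Fintype J] [DecidableEq J]
    (φ : J → J → X × X → R) (v₁ v₂ : J → ℕ)
    (f : ((j : J) → Fin (v₁ j) → X) → R) (g : ((j : J) → Fin (v₂ j) → X) → R) :
    ((j : J) → Fin (v₁ j + v₂ j) → X) → R :=
  fun lam =>
    ∑ τ ∈ Finset.univ.filter
        (fun τ : (j : J) → Equiv.Perm (Fin (v₁ j + v₂ j)) => IsColoredShuffle v₁ v₂ τ),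
      f (fun j s => lam j (τ j (Fin.castAdd (v₂ j) s))) *
      g (fun j t => lam j (τ j (Fin.natAdd (v₁ j) t))) *
      ∏ j : J, ∏ j' : J, ∏ s : Fin (v₁ j), ∏ t : Fin (v₂ j'),
        φ j j' (lam j (τ j (Fin.castAdd (v₂ j) s)), lam j' (τ j' (Fin.natAdd (v₁ j') t)))

/-- The permutation of `{1,…,a+b}` acting by `σ` on the first block and by `ρ` on the second. -/
def blockPerm {a b : ℕ} (σ : Equiv.Perm (Fin a)) (ρ : Equiv.Perm (Fin b)) :
    Equiv.Perm (Fin (a + b)) :=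
  finSumFinEquiv.permCongr (Equiv.sumCongr σ ρ)

@[simp]
theorem blockPerm_castAdd {a b : ℕ} (σ : Equiv.Perm (Fin a)) (ρ : Equiv.Perm (Fin b))
    (i : Fin a) : blockPerm σ ρ (Fin.castAdd b i) = Fin.castAdd b (σ i) := by
  simp [blockPerm, Equiv.permCongr_apply]

@[simp]
theorem blockPerm_natAdd {a b : ℕ} (σ : Equiv.Perm (Fin a)) (ρ : Equiv.Perm (Fin b))
    (i : Fin b) : blockPerm σ ρ (Fin.natAdd a i) = Fin.natAdd a (ρ i) := by
  simp [blockPerm, Equiv.permCongr_apply]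

theorem perm_ext_of_blocks {a b : ℕ} {τ τ' : Equiv.Perm (Fin (a + b))}
    (h₁ : ∀ i, τ (Fin.castAdd b i) = τ' (Fin.castAdd b i))
    (h₂ : ∀ i, τ (Fin.natAdd a i) = τ' (Fin.natAdd a i)) : τ = τ' :=
  Equiv.ext fun i => Fin.addCases h₁ h₂ i

theorem strictMono_comp_sort {a : ℕ} {α : Type*} [LinearOrder α] {f : Fin a → α}
    (hf : Function.Injective f) : StrictMono (fun i => f (Tuple.sort f i)) :=
  (Tuple.monotone_sort f).strictMono_of_injective (hf.comp (Tuple.sort f).injective)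

/-- The factorization of a tuple as a strictly increasing tuple after a permutation is unique. -/
theorem strictMono_comp_perm_unique {a : ℕ} {α : Type*} [LinearOrder α] {g g' : Fin a → α}
    {σ σ' : Equiv.Perm (Fin a)} (hg : StrictMono g) (hg' : StrictMono g')
    (h : ∀ i, g (σ i) = g' (σ' i)) : g = g' ∧ σ = σ' := by
  have hgg : g = g' := by
    refine (StrictMono.range_inj hg hg').1 ?_
    rw [← σ.surjective.range_comp g, ← σ'.surjective.range_comp g']
    exact congrArg Set.range (funext h)
  subst hgg
  exact ⟨rfl, Equiv.ext fun i => hg.injective (h i)⟩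

/-- A permutation of `{1,…,n+m+k}` strictly increasing on each of the three blocks of
lengths `n`, `m` and `k`. -/
def IsTripleShuffle (n m k : ℕ) (π : Equiv.Perm (Fin (n + m + k))) : Prop :=
  StrictMono (fun i : Fin n => π (Fin.castAdd k (Fin.castAdd m i))) ∧
  StrictMono (fun i : Fin m => π (Fin.castAdd k (Fin.natAdd n i))) ∧
  StrictMono (fun i : Fin k => π (Fin.natAdd (n + m) i))

/-- The composite of an `(n+m,k)`-shuffle with an `(n,m)`-shuffle of the first block. -/
def leftComp {n m k : ℕ} (τ : Equiv.Perm (Fin (n + m + k))) (σ : Equiv.Perm (Fin (n + m))) :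
    Equiv.Perm (Fin (n + m + k)) :=
  τ * blockPerm σ 1

@[simp]
theorem leftComp_castAdd {n m k : ℕ} (τ : Equiv.Perm (Fin (n + m + k)))
    (σ : Equiv.Perm (Fin (n + m))) (i : Fin (n + m)) :
    leftComp τ σ (Fin.castAdd k i) = τ (Fin.castAdd k (σ i)) := by
  simp [leftComp]

@[simp]
theorem leftComp_natAdd {n m k : ℕ} (τ : Equiv.Perm (Fin (n + m + k)))
    (σ : Equiv.Perm (Fin (n + m))) (i : Fin k) :
    leftComp τ σ (Fin.natAdd (n + m) i) = τ (Fin.natAdd (n + m) i) := by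
  simp [leftComp]

theorem isTripleShuffle_leftComp {n m k : ℕ} {τ : Equiv.Perm (Fin (n + m + k))}
    {σ : Equiv.Perm (Fin (n + m))} (hτ : IsShuffle (n + m) k τ) (hσ : IsShuffle n m σ) :
    IsTripleShuffle n m k (leftComp τ σ) := by
  refine ⟨?_, ?_, ?_⟩ <;> simp only [leftComp_castAdd, leftComp_natAdd]
  · exact hτ.1.comp hσ.1
  · exact hτ.1.comp hσ.2
  · exact hτ.2

theorem leftComp_injective {n m k : ℕ} {τ τ' : Equiv.Perm (Fin (n + m + k))}
    {σ σ' : Equiv.Perm (Fin (n + m))} (hτ : IsShuffle (n + m) k τ)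
    (hτ' : IsShuffle (n + m) k τ') (h : leftComp τ σ = leftComp τ' σ') : τ = τ' ∧ σ = σ' := by
  obtain ⟨h₁, h₂⟩ := strictMono_comp_perm_unique (σ := σ) (σ' := σ') hτ.1 hτ'.1
    fun i => by simpa using congrArg (· (Fin.castAdd k i)) h
  exact ⟨perm_ext_of_blocks (congrFun h₁)
    fun i => by simpa using congrArg (· (Fin.natAdd (n + m) i)) h, h₂⟩

theorem exists_leftComp_eq {n m k : ℕ} {π : Equiv.Perm (Fin (n + m + k))}
    (hπ : IsTripleShuffle n m k π) :
    ∃ τ σ, IsShuffle (n + m) k τ ∧ IsShuffle n m σ ∧ leftComp τ σ = π := by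
  let s := Tuple.sort fun i : Fin (n + m) => π (Fin.castAdd k i)
  have hs : StrictMono fun i => π (Fin.castAdd k (s i)) :=
    strictMono_comp_sort (π.injective.comp (Fin.castAdd_injective _ _))
  refine ⟨π * blockPerm s 1, s⁻¹, ⟨?_, ?_⟩, ⟨?_, ?_⟩, ?_⟩
  · simpa using hs
  · simpa using hπ.2.2
  · exact fun i j hij => hs.lt_iff_lt.1 (by simpa using hπ.1 hij)
  · exact fun i j hij => hs.lt_iff_lt.1 (by simpa using hπ.2.1 hij)
  · exact perm_ext_of_blocks (by simp) (by simp)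

theorem cast_assoc_first {n m k : ℕ} (i : Fin n) :
    Fin.cast (Nat.add_assoc n m k).symm (Fin.castAdd (m + k) i) =
      Fin.castAdd k (Fin.castAdd m i) :=
  rfl

theorem cast_assoc_second {n m k : ℕ} (i : Fin m) :
    Fin.cast (Nat.add_assoc n m k).symm (Fin.natAdd n (Fin.castAdd k i)) =
      Fin.castAdd k (Fin.natAdd n i) :=
  rfl

theorem cast_assoc_third {n m k : ℕ} (i : Fin k) :
    Fin.cast (Nat.add_assoc n m k).symm (Fin.natAdd n (Fin.natAdd m i)) =
      Fin.natAdd (n + m) i :=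
  Fin.ext (Nat.add_assoc n m i).symm

/-- The composite of an `(n,m+k)`-shuffle with an `(m,k)`-shuffle of the second block, as a
permutation of `{1,…,n+m+k}`. -/
def rightComp {n m k : ℕ} (τ : Equiv.Perm (Fin (n + (m + k)))) (σ : Equiv.Perm (Fin (m + k))) :
    Equiv.Perm (Fin (n + m + k)) :=
  (finCongr (Nat.add_assoc n m k).symm).permCongr (τ * blockPerm 1 σ)

theorem rightComp_cast {n m k : ℕ} (τ : Equiv.Perm (Fin (n + (m + k))))
    (σ : Equiv.Perm (Fin (m + k))) (i : Fin (n + (m + k))) :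
    rightComp τ σ (Fin.cast (Nat.add_assoc n m k).symm i) =
      Fin.cast (Nat.add_assoc n m k).symm (τ (blockPerm 1 σ i)) := by
  simp [rightComp, Equiv.permCongr_apply]

@[simp]
theorem rightComp_first {n m k : ℕ} (τ : Equiv.Perm (Fin (n + (m + k))))
    (σ : Equiv.Perm (Fin (m + k))) (i : Fin n) :
    rightComp τ σ (Fin.castAdd k (Fin.castAdd m i)) =
      Fin.cast (Nat.add_assoc n m k).symm (τ (Fin.castAdd (m + k) i)) := by
  simpa [cast_assoc_first] using rightComp_cast τ σ (Fin.castAdd (m + k) i)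

@[simp]
theorem rightComp_second {n m k : ℕ} (τ : Equiv.Perm (Fin (n + (m + k))))
    (σ : Equiv.Perm (Fin (m + k))) (i : Fin m) :
    rightComp τ σ (Fin.castAdd k (Fin.natAdd n i)) =
      Fin.cast (Nat.add_assoc n m k).symm (τ (Fin.natAdd n (σ (Fin.castAdd k i)))) := by
  simpa [cast_assoc_second] using rightComp_cast τ σ (Fin.natAdd n (Fin.castAdd k i))

@[simp]
theorem rightComp_third {n m k : ℕ} (τ : Equiv.Perm (Fin (n + (m + k))))
    (σ : Equiv.Perm (Fin (m + k))) (i : Fin k) :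
    rightComp τ σ (Fin.natAdd (n + m) i) =
      Fin.cast (Nat.add_assoc n m k).symm (τ (Fin.natAdd n (σ (Fin.natAdd m i)))) := by
  simpa [cast_assoc_third] using rightComp_cast τ σ (Fin.natAdd n (Fin.natAdd m i))

theorem isTripleShuffle_rightComp {n m k : ℕ} {τ : Equiv.Perm (Fin (n + (m + k)))}
    {σ : Equiv.Perm (Fin (m + k))} (hτ : IsShuffle n (m + k) τ) (hσ : IsShuffle m k σ) :
    IsTripleShuffle n m k (rightComp τ σ) := by
  refine ⟨?_, ?_, ?_⟩ <;> simp only [rightComp_first, rightComp_second, rightComp_third]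
  · exact fun i j hij => hτ.1 hij
  · exact fun i j hij => hτ.2 (hσ.1 hij)
  · exact fun i j hij => hτ.2 (hσ.2 hij)

theorem rightComp_injective {n m k : ℕ} {τ τ' : Equiv.Perm (Fin (n + (m + k)))}
    {σ σ' : Equiv.Perm (Fin (m + k))} (hτ : IsShuffle n (m + k) τ)
    (hτ' : IsShuffle n (m + k) τ') (h : rightComp τ σ = rightComp τ' σ') :
    τ = τ' ∧ σ = σ' := by
  replace h : τ * blockPerm 1 σ = τ' * blockPerm 1 σ' := Equiv.injective _ h
  obtain ⟨h₁, h₂⟩ := strictMono_comp_perm_unique (σ := σ) (σ' := σ') hτ.2 hτ'.2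
    fun i => by simpa using congrArg (· (Fin.natAdd n i)) h
  exact ⟨perm_ext_of_blocks
    (fun i => by simpa using congrArg (· (Fin.castAdd (m + k) i)) h) (congrFun h₁), h₂⟩

theorem exists_rightComp_eq {n m k : ℕ} {π : Equiv.Perm (Fin (n + m + k))}
    (hπ : IsTripleShuffle n m k π) :
    ∃ τ σ, IsShuffle n (m + k) τ ∧ IsShuffle m k σ ∧ rightComp τ σ = π := by
  obtain ⟨ρ, rfl⟩ : ∃ ρ, rightComp ρ 1 = π := by
    refine ⟨(finCongr (Nat.add_assoc n m k)).permCongr π, perm_ext_of_blocks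
      (fun i => Fin.addCases (fun i => ?_) (fun i => ?_) i) fun i => ?_⟩ <;>
    simp [Equiv.permCongr_apply, cast_assoc_first, cast_assoc_second, cast_assoc_third]
  simp only [IsTripleShuffle, rightComp_first, rightComp_second, rightComp_third] at hπ
  let s := Tuple.sort fun i : Fin (m + k) => ρ (Fin.natAdd n i)
  have hs : StrictMono fun i => ρ (Fin.natAdd n (s i)) :=
    strictMono_comp_sort (ρ.injective.comp (Fin.natAdd_injective _ _))
  refine ⟨ρ * blockPerm 1 s, s⁻¹, ⟨?_, ?_⟩, ⟨?_, ?_⟩, ?_⟩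
  · exact fun i j hij => by simpa using hπ.1 hij
  · simpa using hs
  · exact fun i j hij => hs.lt_iff_lt.1 (by simpa using hπ.2.1 hij)
  · exact fun i j hij => hs.lt_iff_lt.1 (by simpa using hπ.2.2 hij)
  · refine perm_ext_of_blocks
      (fun i => Fin.addCases (fun i => ?_) (fun i => ?_) i) fun i => ?_ <;> simp

/-- The product of the kernels over all pairs formed by an entry of `x` and an entry of `y`. -/
def kernelProd {R X J : Type*} [CommRing R] [Fintype J] (φ : J → J → X × X → R)
    {v w : J → ℕ} (x : (j : J) → Fin (v j) → X) (y : (j : J) → Fin (w j) → X) : R :=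
  ∏ j : J, ∏ j' : J, ∏ s : Fin (v j), ∏ t : Fin (w j'), φ j j' (x j s, y j' t)

theorem kernelProd_add_left {R X J : Type*} [CommRing R] [Fintype J] (φ : J → J → X × X → R)
    {v₁ v₂ w : J → ℕ} (x : (j : J) → Fin (v₁ j + v₂ j) → X) (y : (j : J) → Fin (w j) → X)
    (σ : (j : J) → Equiv.Perm (Fin (v₁ j + v₂ j))) :
    kernelProd φ x y =
      kernelProd φ (fun j s => x j (σ j (Fin.castAdd (v₂ j) s))) y *
      kernelProd φ (fun j s => x j (σ j (Fin.natAdd (v₁ j) s))) y := by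
  simp only [kernelProd, ← Finset.prod_mul_distrib]
  refine Finset.prod_congr rfl fun j _ => Finset.prod_congr rfl fun j' _ => ?_
  rw [← Equiv.prod_comp (σ j), Fin.prod_univ_add]

theorem kernelProd_add_right {R X J : Type*} [CommRing R] [Fintype J] (φ : J → J → X × X → R)
    {v w₁ w₂ : J → ℕ} (x : (j : J) → Fin (v j) → X) (y : (j : J) → Fin (w₁ j + w₂ j) → X)
    (σ : (j : J) → Equiv.Perm (Fin (w₁ j + w₂ j))) :
    kernelProd φ x y =
      kernelProd φ x (fun j s => y j (σ j (Fin.castAdd (w₂ j) s))) *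
      kernelProd φ x (fun j s => y j (σ j (Fin.natAdd (w₁ j) s))) := by
  simp only [kernelProd, ← Finset.prod_mul_distrib]
  refine Finset.prod_congr rfl fun j _ => Finset.prod_congr rfl fun j' _ =>
    Finset.prod_congr rfl fun s _ => ?_
  rw [← Equiv.prod_comp (σ j'), Fin.prod_univ_add]

theorem coloredShuffleMul_eq_sum_kernelProd {R X J : Type*} [CommRing R] [Fintype J]
    [DecidableEq J] (φ : J → J → X × X → R) (v₁ v₂ : J → ℕ)
    (f : ((j : J) → Fin (v₁ j) → X) → R) (g : ((j : J) → Fin (v₂ j) → X) → R)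
    (lam : (j : J) → Fin (v₁ j + v₂ j) → X) :
    coloredShuffleMul φ v₁ v₂ f g lam =
      ∑ τ : (j : J) → Equiv.Perm (Fin (v₁ j + v₂ j)) with IsColoredShuffle v₁ v₂ τ,
        f (fun j s => lam j (τ j (Fin.castAdd (v₂ j) s))) *
        g (fun j t => lam j (τ j (Fin.natAdd (v₁ j) t))) *
        kernelProd φ (fun j s => lam j (τ j (Fin.castAdd (v₂ j) s)))
          (fun j t => lam j (τ j (Fin.natAdd (v₁ j) t))) :=
  rfl

/-- The product of three functions over the blocks `x`, `y`, `z` with all kernels between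
distinct blocks. -/
def tripleTerm {R X J : Type*} [CommRing R] [Fintype J] (φ : J → J → X × X → R)
    {v₁ v₂ v₃ : J → ℕ} (f : ((j : J) → Fin (v₁ j) → X) → R)
    (g : ((j : J) → Fin (v₂ j) → X) → R) (h : ((j : J) → Fin (v₃ j) → X) → R)
    (x : (j : J) → Fin (v₁ j) → X) (y : (j : J) → Fin (v₂ j) → X)
    (z : (j : J) → Fin (v₃ j) → X) : R :=
  f x * g y * h z * (kernelProd φ x y * kernelProd φ x z * kernelProd φ y z)

/-- The symmetric form of the triple product: a sum over triple shuffles. -/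
def coloredTripleSum {R X J : Type*} [CommRing R] [Fintype J] [DecidableEq J]
    (φ : J → J → X × X → R) {v₁ v₂ v₃ : J → ℕ} (f : ((j : J) → Fin (v₁ j) → X) → R)
    (g : ((j : J) → Fin (v₂ j) → X) → R) (h : ((j : J) → Fin (v₃ j) → X) → R)
    (lam : (j : J) → Fin (v₁ j + v₂ j + v₃ j) → X) : R :=
  ∑ π : (j : J) → Equiv.Perm (Fin (v₁ j + v₂ j + v₃ j)) with
      ∀ j, IsTripleShuffle (v₁ j) (v₂ j) (v₃ j) (π j),
    tripleTerm φ f g h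
      (fun j s => lam j (π j (Fin.castAdd (v₃ j) (Fin.castAdd (v₂ j) s))))
      (fun j s => lam j (π j (Fin.castAdd (v₃ j) (Fin.natAdd (v₁ j) s))))
      (fun j s => lam j (π j (Fin.natAdd (v₁ j + v₂ j) s)))

theorem coloredShuffleMul_left_eq_tripleSum {R X J : Type*} [CommRing R] [Fintype J]
    [DecidableEq J] (φ : J → J → X × X → R) (v₁ v₂ v₃ : J → ℕ)
    (f : ((j : J) → Fin (v₁ j) → X) → R) (g : ((j : J) → Fin (v₂ j) → X) → R)
    (h : ((j : J) → Fin (v₃ j) → X) → R) (lam : (j : J) → Fin (v₁ j + v₂ j + v₃ j) → X) :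
    coloredShuffleMul φ (fun j => v₁ j + v₂ j) v₃ (coloredShuffleMul φ v₁ v₂ f g) h lam =
      coloredTripleSum φ f g h lam := by
  simp only [coloredShuffleMul_eq_sum_kernelProd, Finset.sum_mul]
  rw [← Finset.sum_product', coloredTripleSum]
  refine Finset.sum_bij (fun p _ j => leftComp (p.1 j) (p.2 j)) ?_ ?_ ?_ ?_
  · rintro ⟨τ, σ⟩ hp
    simp only [Finset.mem_product, Finset.mem_filter_univ] at hp ⊢
    exact fun j => isTripleShuffle_leftComp (hp.1 j) (hp.2 j)
  · rintro ⟨τ, σ⟩ hp ⟨τ', σ'⟩ hp' heq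
    simp only [Finset.mem_product, Finset.mem_filter_univ] at hp hp'
    have key := fun j => leftComp_injective (hp.1 j) (hp'.1 j) (congrFun heq j)
    exact Prod.ext (funext fun j => (key j).1) (funext fun j => (key j).2)
  · intro π hπ
    choose τ σ hτ hσ hc using fun j => exists_leftComp_eq ((Finset.mem_filter_univ _).1 hπ j)
    exact ⟨(τ, σ), by
      simpa only [Finset.mem_product, Finset.mem_filter_univ] using ⟨hτ, hσ⟩, funext hc⟩
  · rintro ⟨τ, σ⟩ -
    simp only [tripleTerm, leftComp_castAdd, leftComp_natAdd]
    rw [kernelProd_add_left φ (fun j s => lam j (τ j (Fin.castAdd (v₃ j) s))) _ σ]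
    ring

theorem coloredShuffleMul_right_eq_tripleSum {R X J : Type*} [CommRing R] [Fintype J]
    [DecidableEq J] (φ : J → J → X × X → R) (v₁ v₂ v₃ : J → ℕ)
    (f : ((j : J) → Fin (v₁ j) → X) → R) (g : ((j : J) → Fin (v₂ j) → X) → R)
    (h : ((j : J) → Fin (v₃ j) → X) → R) (lam : (j : J) → Fin (v₁ j + v₂ j + v₃ j) → X) :
    coloredShuffleMul φ v₁ (fun j => v₂ j + v₃ j) f (coloredShuffleMul φ v₂ v₃ g h)
        (fun j i => lam j (Fin.cast (Nat.add_assoc (v₁ j) (v₂ j) (v₃ j)).symm i)) =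
      coloredTripleSum φ f g h lam := by
  simp only [coloredShuffleMul_eq_sum_kernelProd, Finset.sum_mul, Finset.mul_sum]
  rw [← Finset.sum_product', coloredTripleSum]
  refine Finset.sum_bij (fun p _ j => rightComp (p.1 j) (p.2 j)) ?_ ?_ ?_ ?_
  · rintro ⟨τ, σ⟩ hp
    simp only [Finset.mem_product, Finset.mem_filter_univ] at hp ⊢
    exact fun j => isTripleShuffle_rightComp (hp.1 j) (hp.2 j)
  · rintro ⟨τ, σ⟩ hp ⟨τ', σ'⟩ hp' heq
    simp only [Finset.mem_product, Finset.mem_filter_univ] at hp hp'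
    have key := fun j => rightComp_injective (hp.1 j) (hp'.1 j) (congrFun heq j)
    exact Prod.ext (funext fun j => (key j).1) (funext fun j => (key j).2)
  · intro π hπ
    choose τ σ hτ hσ hc using fun j => exists_rightComp_eq ((Finset.mem_filter_univ _).1 hπ j)
    exact ⟨(τ, σ), by
      simpa only [Finset.mem_product, Finset.mem_filter_univ] using ⟨hτ, hσ⟩, funext hc⟩
  · rintro ⟨τ, σ⟩ -
    simp only [tripleTerm, rightComp_first, rightComp_second, rightComp_third]
    rw [kernelProd_add_right φ _ (fun j t => lam j (Fin.cast
      (Nat.add_assoc (v₁ j) (v₂ j) (v₃ j)).symm (τ j (Fin.natAdd (v₁ j) t)))) σ]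
    ring

/-- Associativity of the colored shuffle product. -/
theorem coloredShuffleMul_assoc {R X J : Type*} [CommRing R] [Fintype J] [DecidableEq J]
    (φ : J → J → X × X → R) (v₁ v₂ v₃ : J → ℕ)
    (f : ((j : J) → Fin (v₁ j) → X) → R) (g : ((j : J) → Fin (v₂ j) → X) → R)
    (h : ((j : J) → Fin (v₃ j) → X) → R) :
    ∀ lam : (j : J) → Fin (v₁ j + v₂ j + v₃ j) → X,
      coloredShuffleMul φ (fun j => v₁ j + v₂ j) v₃ (coloredShuffleMul φ v₁ v₂ f g) h lam =
      coloredShuffleMul φ v₁ (fun j => v₂ j + v₃ j) f (coloredShuffleMul φ v₂ v₃ g h)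
        (fun j i => lam j (Fin.cast (Nat.add_assoc (v₁ j) (v₂ j) (v₃ j)).symm i)) := by
  intro lam
  rw [coloredShuffleMul_left_eq_tripleSum, coloredShuffleMul_right_eq_tripleSum]
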